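/- arXiv:1303.0944 — 6 statements merged into one kernel-verified Lean document; each statement's English description precedes it below -/
import Mathlib

section
/- Let G be a finite simple graph and let G' be the graph obtained from G by adding one new vertex adjacent to all vertices of G. Then G is total domishold if and only if G' is total domishold. -/
/-- A total dominating set: every vertex of the graph has a neighbor in `D`. -/
def TotalDomSet {V : Type*} (G : SimpleGraph V) (D : Finset V) : Prop :=
  ∀ v : V, ∃ u ∈ D, G.Adj v u

/-- A graph is total domishold if there are nonnegative weights and a threshold such that
a set of vertices is a total dominating set iff its total weight reaches the threshold. -/
def TotalDomishold {V : Type*} [Fintype V] (G : SimpleGraph V) : Prop :=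
  ∃ (w : V → NNReal) (t : NNReal), ∀ S : Finset V, t ≤ ∑ x ∈ S, w x ↔ TotalDomSet G S

/-- A set avoiding the new vertex is total dominating in the extended graph iff it is nonempty
and total dominating in the original graph. -/
theorem totalDomSet_map_some_iff {V : Type*} {G : SimpleGraph V} {G' : SimpleGraph (Option V)}
    (h1 : ∀ u v : V, G'.Adj (some u) (some v) ↔ G.Adj u v)
    (h2 : ∀ v : V, G'.Adj none (some v)) (U : Finset V) :
    TotalDomSet G' (U.map Function.Embedding.some) ↔ U.Nonempty ∧ TotalDomSet G U := by
  simp [TotalDomSet, Option.forall, h1, h2, Finset.Nonempty]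

/-- A set containing the new vertex is total dominating in the extended graph iff it contains
some other vertex. -/
theorem totalDomSet_insertNone_iff {V : Type*} {G' : SimpleGraph (Option V)}
    (h2 : ∀ v : V, G'.Adj none (some v)) (U : Finset V) :
    TotalDomSet G' (Finset.insertNone U) ↔ U.Nonempty := by
  simp [TotalDomSet, Option.forall, Option.exists, h2, (h2 _).symm, Finset.Nonempty]

theorem Finset.eq_insertNone_or_eq_map_some {V : Type*} (S : Finset (Option V)) :
    ∃ U : Finset V, S = insertNone U ∨ S = U.map Function.Embedding.some := by
  classical
  refine ⟨eraseNone S, ?_⟩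
  by_cases h : none ∈ S
  · left; simp [h]
  · right; simp [h]

/-- All weights can be increased by a small positive amount without lifting any set of total
weight below a positive threshold to that threshold. -/
theorem exists_pos_sum_add_lt {V : Type*} [Fintype V] (w : V → NNReal) {t : NNReal}
    (ht : 0 < t) :
    ∃ ε : NNReal, 0 < ε ∧ ε ≤ t ∧
      ∀ S : Finset V, ∑ x ∈ S, w x < t → ∑ x ∈ S, (w x + ε) < t := by
  have key : ∀ᶠ ε in nhdsWithin (0 : NNReal) (Set.Ioi 0),
      ∀ S : Finset V, ∑ x ∈ S, w x < t → ∑ x ∈ S, (w x + ε) < t := by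
    refine nhdsWithin_le_nhds (Filter.eventually_all.2 fun S ↦ ?_)
    by_cases hS : ∑ x ∈ S, w x < t
    · have hc : Continuous fun ε : NNReal ↦ ∑ x ∈ S, (w x + ε) := by fun_prop
      filter_upwards [hc.continuousAt.eventually_lt_const (by simpa using hS)] with ε hε _
      exact hε
    · simp [hS]
  obtain ⟨ε, ⟨hε, hεt⟩, hpos⟩ := ((key.and (nhdsWithin_le_nhds (Iic_mem_nhds ht))).and
    self_mem_nhdsWithin).exists
  exact ⟨ε, hpos, hεt, hε⟩

/-- If `G'` is obtained from `G` by adding a new vertex adjacent to all vertices of `G`,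
then `G` is total domishold iff `G'` is total domishold. -/
theorem stmt_2 {V : Type*} [Fintype V] (G : SimpleGraph V) (G' : SimpleGraph (Option V))
    (h1 : ∀ u v : V, G'.Adj (some u) (some v) ↔ G.Adj u v)
    (h2 : ∀ v : V, G'.Adj none (some v)) :
    TotalDomishold G ↔ TotalDomishold G' := by
  rcases isEmpty_or_nonempty V with hV | hV
  · refine iff_of_true ⟨0, 0, fun S ↦ by simp [TotalDomSet]⟩ ⟨0, 1, fun S ↦ ?_⟩
    simp [TotalDomSet, Option.forall, Option.exists]
  have not_empty : ¬ TotalDomSet G ∅ := by simp [TotalDomSet]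
  have nonempty_of {U : Finset V} (hU : TotalDomSet G U) : U.Nonempty :=
    Finset.nonempty_iff_ne_empty.2 fun h ↦ not_empty (h ▸ hU)
  constructor
  · rintro ⟨w, t, hw⟩
    have ht : 0 < t := by
      by_contra h
      exact not_empty ((hw ∅).1 (by simpa using h))
    obtain ⟨ε, hε, hεt, hlt⟩ := exists_pos_sum_add_lt w ht
    refine ⟨fun x ↦ x.elim (t - ε) (fun v ↦ w v + ε), t, fun S ↦ ?_⟩
    obtain ⟨U, rfl | rfl⟩ := S.eq_insertNone_or_eq_map_some
    · rw [totalDomSet_insertNone_iff h2, Finset.sum_insertNone]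
      simp only [Option.elim_none, Option.elim_some]
      refine ⟨fun h ↦ ?_, fun ⟨v, hv⟩ ↦ ?_⟩
      · by_contra hU
        rw [Finset.not_nonempty_iff_eq_empty.1 hU, Finset.sum_empty, add_zero] at h
        exact absurd h (tsub_lt_self ht hε).not_ge
      · calc t = (t - ε) + ε := (tsub_add_cancel_of_le hεt).symm
          _ ≤ (t - ε) + (w v + ε) := by gcongr; exact le_add_self
          _ ≤ _ := by
            gcongr
            exact Finset.single_le_sum (f := fun x ↦ w x + ε) (fun _ _ ↦ zero_le) hv
    · rw [totalDomSet_map_some_iff h1 h2, and_iff_right_of_imp nonempty_of, ← hw,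
        Finset.sum_map]
      simp only [Function.Embedding.some_apply, Option.elim_some]
      refine ⟨fun h ↦ ?_, fun h ↦ h.trans (Finset.sum_le_sum fun _ _ ↦ le_self_add)⟩
      by_contra hU
      exact absurd h (hlt U (not_le.1 hU)).not_ge
  · rintro ⟨w, t, hw⟩
    refine ⟨fun v ↦ w (some v), t, fun U ↦ ?_⟩
    have := hw (U.map Function.Embedding.some)
    rwa [totalDomSet_map_some_iff h1 h2, and_iff_right_of_imp nonempty_of,
      Finset.sum_map] at this
end

section
/- Every threshold finite simple graph is hereditary total domishold. -/
/-- A graph is hereditary total domishold if each of its induced subgraphs is total domishold. -/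
def HereditaryTD {V : Type*} [Fintype V] (G : SimpleGraph V) : Prop :=
  ∀ A : Finset V, TotalDomishold (G.induce (↑A : Set V))

/-- A graph is threshold if there are nonnegative weights and a threshold such that a set of
vertices is independent iff its total weight is at most the threshold. -/
def ThresholdGraph {V : Type*} [Fintype V] (G : SimpleGraph V) : Prop :=
  ∃ (w : V → NNReal) (t : NNReal), ∀ S : Finset V,
    ∑ x ∈ S, w x ≤ t ↔ ∀ u ∈ S, ∀ v ∈ S, ¬ G.Adj u v

/-- In a threshold graph, adjacency of distinct vertices is decided by comparing the sum of their
weights with the threshold. -/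
theorem ThresholdGraph.exists_adj_iff {V : Type*} [Fintype V] {G : SimpleGraph V}
    (h : ThresholdGraph G) :
    ∃ (w : V → NNReal) (t : NNReal), ∀ u v : V, u ≠ v → (G.Adj u v ↔ t < w u + w v) := by
  classical
  obtain ⟨w, t, hw⟩ := h
  refine ⟨w, t, fun u v huv => ?_⟩
  have hpair := hw {u, v}
  rw [Finset.sum_pair huv] at hpair
  rw [← not_le, hpair]
  simp [G.adj_comm v u]

/-- A graph with a vertex all of whose neighbors are universal is total domishold. -/
theorem TotalDomishold.of_neighbors_universal {V : Type*} [Fintype V] {G : SimpleGraph V} (r : V)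
    (hr : ∀ u, G.Adj r u → ∀ v, v ≠ u → G.Adj u v) : TotalDomishold G := by
  classical
  have hpos : 1 ≤ Fintype.card V := Fintype.card_pos_iff.mpr ⟨r⟩
  let c : V → ℕ := fun u => if ∀ v, v ≠ u → G.Adj u v then Fintype.card V else 1
  have hc_ge : ∀ u, 1 ≤ c u := fun u => by dsimp only [c]; split_ifs <;> omega
  have hc_le : ∀ u, c u ≤ Fintype.card V := fun u => by dsimp only [c]; split_ifs <;> omega
  have hc_univ : ∀ u, (∀ v, v ≠ u → G.Adj u v) → c u = Fintype.card V := fun u hu => if_pos hu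
  refine ⟨fun u => c u, (Fintype.card V + 1 : ℕ), fun S => ?_⟩
  rw [← Nat.cast_sum, Nat.cast_le]
  constructor
  · intro hS
    have huniv : ∃ u ∈ S, ∀ v, v ≠ u → G.Adj u v := by
      by_contra hno
      have hsum : ∑ x ∈ S, c x = S.card := by
        rw [Finset.card_eq_sum_ones]
        exact Finset.sum_congr rfl fun x hx => if_neg fun hx' => hno ⟨x, hx, hx'⟩
      have := S.card_le_univ
      omega
    obtain ⟨u, huS, hu⟩ := huniv
    have hother : ∃ x ∈ S, x ≠ u := by
      by_contra! hno
      have hsing : S = {u} := Finset.eq_singleton_iff_unique_mem.mpr ⟨huS, hno⟩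
      rw [hsing, Finset.sum_singleton] at hS
      have := hc_le u
      omega
    obtain ⟨x, hxS, hxu⟩ := hother
    intro v
    by_cases hv : v = u
    · exact ⟨x, hxS, hv ▸ hu x hxu⟩
    · exact ⟨u, huS, (hu v hv).symm⟩
  · intro hS
    obtain ⟨u, huS, hru⟩ := hS r
    obtain ⟨x, hxS, hux⟩ := hS u
    calc Fintype.card V + 1 ≤ c u + c x := by
          rw [hc_univ u (hr u hru)]
          exact Nat.add_le_add_left (hc_ge x) _
      _ = ∑ y ∈ {u, x}, c y := (Finset.sum_pair hux.ne).symm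
      _ ≤ ∑ y ∈ S, c y :=
          Finset.sum_le_sum_of_subset (by simp [Finset.insert_subset_iff, huS, hxS])

/-- Every threshold graph is hereditary total domishold. -/
theorem stmt_3 {V : Type*} [Fintype V] (G : SimpleGraph V) (h : ThresholdGraph G) :
    HereditaryTD G := by
  intro A
  obtain ⟨w, t, hw⟩ := h.exists_adj_iff
  rcases isEmpty_or_nonempty (↑A : Set V) with hA | hA
  · exact ⟨0, 0, fun S => ⟨fun _ v => hA.elim v, fun _ => zero_le⟩⟩
  · obtain ⟨r, hr⟩ := Finite.exists_min fun a : (↑A : Set V) => w a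
    refine TotalDomishold.of_neighbors_universal r fun u hru v hvu => ?_
    rw [SimpleGraph.comap_adj] at hru ⊢
    refine (hw _ _ fun huv => hvu (Subtype.ext huv.symm)).mpr ?_
    calc t < w r + w u := (hw _ _ hru.ne).mp hru
      _ ≤ w v + w u := by gcongr; exact hr v
      _ = w u + w v := add_comm _ _
end

section
/- Every co-domishold finite simple graph is hereditary total domishold. -/
/-- A dominating set: every vertex is in `D` or has a neighbor in `D`. -/
def DomSet {V : Type*} (G : SimpleGraph V) (D : Finset V) : Prop :=
  ∀ v : V, v ∈ D ∨ ∃ u ∈ D, G.Adj v u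

/-- A graph is domishold if there are nonnegative weights and a threshold such that
a set of vertices is a dominating set iff its total weight reaches the threshold. -/
def Domishold {V : Type*} [Fintype V] (G : SimpleGraph V) : Prop :=
  ∃ (w : V → NNReal) (t : NNReal), ∀ S : Finset V, t ≤ ∑ x ∈ S, w x ↔ DomSet G S

open Classical in
/-- The sets of vertices inducing a graph built from the empty graph by adding isolated vertices,
universal vertices and isolated edges. -/
inductive EdgeThreshold {V : Type*} (G : SimpleGraph V) : Finset V → Prop
  | empty : EdgeThreshold G ∅
  | isolated {A : Finset V} {v : V} (hv : v ∉ A) (h : ∀ x ∈ A, ¬ G.Adj v x)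
      (hA : EdgeThreshold G A) : EdgeThreshold G (insert v A)
  | universal {A : Finset V} {v : V} (hv : v ∉ A) (h : ∀ x ∈ A, G.Adj v x)
      (hA : EdgeThreshold G A) : EdgeThreshold G (insert v A)
  | edge {A : Finset V} {a b : V} (ha : a ∉ A) (hb : b ∉ A) (hab : G.Adj a b)
      (hna : ∀ x ∈ A, ¬ G.Adj a x) (hnb : ∀ x ∈ A, ¬ G.Adj b x)
      (hA : EdgeThreshold G A) : EdgeThreshold G (insert a (insert b A))

/-- The subsets of `A` contained in the neighborhood of a vertex of `A` are those of weight
below some threshold. -/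
def NeighborhoodThreshold {V : Type*} (G : SimpleGraph V) (A : Finset V) : Prop :=
  ∃ (w : V → ℝ) (t : ℝ), ∀ S ⊆ A, ∑ x ∈ S, w x < t ↔ ∃ v ∈ A, ∀ x ∈ S, G.Adj v x

/-- The total dominating sets of the graph induced by `A` are the subsets of `A` reaching some
threshold, with respect to positive weights. -/
def TotalDomThreshold {V : Type*} (G : SimpleGraph V) (A : Finset V) : Prop :=
  ∃ (w : V → ℝ) (t : ℝ), (∀ x, 0 < w x) ∧ 0 ≤ t ∧
    ∀ S ⊆ A, t ≤ ∑ x ∈ S, w x ↔ ∀ v ∈ A, ∃ u ∈ S, G.Adj v u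

open Classical in
theorem EdgeThreshold.inter {V : Type*} {G : SimpleGraph V} {A : Finset V}
    (h : EdgeThreshold G A) (B : Finset V) : EdgeThreshold G (A ∩ B) := by
  induction h with
  | empty => simpa using EdgeThreshold.empty
  | @isolated A v hv h hA ih =>
    by_cases hB : v ∈ B
    · rw [Finset.insert_inter_of_mem hB]
      exact .isolated (by simp [hv]) (fun x hx => h x (Finset.mem_inter.1 hx).1) ih
    · rwa [Finset.insert_inter_of_notMem hB]
  | @universal A v hv h hA ih =>
    by_cases hB : v ∈ B
    · rw [Finset.insert_inter_of_mem hB]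
      exact .universal (by simp [hv]) (fun x hx => h x (Finset.mem_inter.1 hx).1) ih
    · rwa [Finset.insert_inter_of_notMem hB]
  | @edge A a b ha hb hab hna hnb hA ih =>
    have hna' : ∀ x ∈ A ∩ B, ¬ G.Adj a x := fun x hx => hna x (Finset.mem_inter.1 hx).1
    have hnb' : ∀ x ∈ A ∩ B, ¬ G.Adj b x := fun x hx => hnb x (Finset.mem_inter.1 hx).1
    by_cases hB : b ∈ B <;> by_cases hB' : a ∈ B
    · rw [Finset.insert_inter_of_mem hB', Finset.insert_inter_of_mem hB]
      exact .edge (by simp [ha]) (by simp [hb]) hab hna' hnb' ih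
    · rw [Finset.insert_inter_of_notMem hB', Finset.insert_inter_of_mem hB]
      exact .isolated (by simp [hb]) hnb' ih
    · rw [Finset.insert_inter_of_mem hB', Finset.insert_inter_of_notMem hB]
      exact .isolated (by simp [ha]) hna' ih
    · rwa [Finset.insert_inter_of_notMem hB', Finset.insert_inter_of_notMem hB]

theorem EdgeThreshold.mono {V : Type*} {G : SimpleGraph V} {A B : Finset V}
    (h : EdgeThreshold G A) (hBA : B ⊆ A) : EdgeThreshold G B := by
  classical
  simpa [Finset.inter_eq_right.2 hBA] using h.inter B

theorem sum_update_eq_ite_add_sum_erase {V : Type*} [DecidableEq V] (w : V → ℝ) (u : V) (c : ℝ)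
    (S : Finset V) :
    ∑ x ∈ S, Function.update w u c x = (if u ∈ S then c else 0) + ∑ x ∈ S.erase u, w x := by
  have key : ∑ x ∈ S.erase u, Function.update w u c x = ∑ x ∈ S.erase u, w x :=
    Finset.sum_congr rfl fun x hx => Function.update_of_ne (Finset.ne_of_mem_erase hx) _ _
  by_cases hu : u ∈ S
  · rw [← Finset.add_sum_erase S _ hu, key]
    simp [hu]
  · rw [← key, Finset.erase_eq_of_notMem hu]
    simp [hu]

theorem totalDomThreshold_of_isolated {V : Type*} {G : SimpleGraph V} {A : Finset V} {v : V}
    (hv : v ∈ A) (h : ∀ x ∈ A, ¬ G.Adj v x) : TotalDomThreshold G A := by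
  refine ⟨fun _ => 1, A.card + 1, by simp, by positivity, fun S hS => ⟨fun hw => ?_, fun hd => ?_⟩⟩
  · have : (S.card : ℝ) ≤ A.card := by exact_mod_cast Finset.card_le_card hS
    simp at hw
    linarith
  · obtain ⟨u, hu, huv⟩ := hd v hv
    exact absurd huv (h u (hS hu))

theorem TotalDomThreshold.insert_universal {V : Type*} [DecidableEq V] {G : SimpleGraph V}
    {A : Finset V} {u : V} (hA : TotalDomThreshold G A) (hne : A.Nonempty) (hu : u ∉ A)
    (h : ∀ x ∈ A, G.Adj u x) : TotalDomThreshold G (insert u A) := by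
  obtain ⟨w, t, hw, ht, hS⟩ := hA
  obtain ⟨x₀, hx₀, hmin⟩ := Finset.exists_min_image A w hne
  have hlt : w x₀ < t := by
    by_contra! hle
    have := (hS {x₀} (by simpa using hx₀)).1 (by simpa using hle) x₀ hx₀
    simp at this
  refine ⟨Function.update w u (t - w x₀), t, fun x => ?_, ht, fun S hSA => ?_⟩
  · by_cases hx : x = u
    · subst hx
      simpa using hlt
    · simpa [hx] using hw x
  · have hT : S.erase u ⊆ A := by
      rwa [← Finset.subset_insert_iff]
    rw [sum_update_eq_ite_add_sum_erase]
    by_cases huS : u ∈ S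
    · rw [if_pos huS]
      constructor
      · intro hle v hv
        rcases Finset.mem_insert.1 hv with rfl | hv
        · obtain ⟨y, hy⟩ : (S.erase v).Nonempty := by
            rw [Finset.nonempty_iff_ne_empty]
            intro h0
            rw [h0, Finset.sum_empty] at hle
            linarith [hw x₀]
          exact ⟨y, Finset.mem_of_mem_erase hy, h y (hT hy)⟩
        · exact ⟨u, huS, (h v hv).symm⟩
      · intro hd
        obtain ⟨y, hy, huy⟩ := hd u (Finset.mem_insert_self _ _)
        have hyT : y ∈ S.erase u := Finset.mem_erase.2 ⟨huy.ne', hy⟩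
        have h1 := Finset.single_le_sum (f := w) (fun x _ => (hw x).le) hyT
        linarith [hmin y (hT hyT)]
    · rw [Finset.erase_eq_of_notMem huS] at hT ⊢
      rw [if_neg huS, zero_add, hS S hT]
      refine ⟨fun hd v hv => ?_, fun hd v hv => hd v (Finset.mem_insert_of_mem hv)⟩
      rcases Finset.mem_insert.1 hv with rfl | hv
      · obtain ⟨y, hy, -⟩ := hd x₀ hx₀
        exact ⟨y, hy, h y (hT hy)⟩
      · exact hd v hv

theorem TotalDomThreshold.insert_edge {V : Type*} [DecidableEq V] {G : SimpleGraph V}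
    {A : Finset V} {a b : V} (hA : TotalDomThreshold G A) (ha : a ∉ A) (hb : b ∉ A)
    (hab : G.Adj a b) (hna : ∀ x ∈ A, ¬ G.Adj a x) (hnb : ∀ x ∈ A, ¬ G.Adj b x) :
    TotalDomThreshold G (insert a (insert b A)) := by
  obtain ⟨w, t, hw, ht, hS⟩ := hA
  have hM : 0 ≤ ∑ x ∈ A, w x := Finset.sum_nonneg fun x _ => (hw x).le
  set M := ∑ x ∈ A, w x + 1 with hMdef
  refine ⟨Function.update (Function.update w b M) a M, 2 * M + t, fun x => ?_, by linarith,
    fun S hSA => ?_⟩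
  · simp only [Function.update_apply]
    split_ifs
    · linarith
    · linarith
    · exact hw x
  · have hT : (S.erase a).erase b ⊆ A := by
      rwa [← Finset.subset_insert_iff, ← Finset.subset_insert_iff]
    have hTle : ∑ x ∈ (S.erase a).erase b, w x ≤ ∑ x ∈ A, w x :=
      Finset.sum_le_sum_of_subset_of_nonneg hT fun x _ _ => (hw x).le
    have hbS : b ∈ S.erase a ↔ b ∈ S := by simp [hab.ne']
    have hmem : ∀ x ∈ S, x = a ∨ x = b ∨ x ∈ (S.erase a).erase b := by
      intro x hx
      simp only [Finset.mem_erase]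
      tauto
    have hsub : (S.erase a).erase b ⊆ S := (Finset.erase_subset _ _).trans (Finset.erase_subset _ _)
    rw [sum_update_eq_ite_add_sum_erase, sum_update_eq_ite_add_sum_erase]
    simp only [hbS]
    constructor
    · intro hle
      have haS : a ∈ S := by
        by_contra hc
        rw [if_neg hc] at hle
        split_ifs at hle <;> linarith
      have hbS' : b ∈ S := by
        by_contra hc
        rw [if_neg hc] at hle
        split_ifs at hle
        linarith
      rw [if_pos haS, if_pos hbS'] at hle
      intro v hv
      rcases Finset.mem_insert.1 hv with rfl | hv
      · exact ⟨b, hbS', hab⟩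
      rcases Finset.mem_insert.1 hv with rfl | hv
      · exact ⟨a, haS, hab.symm⟩
      obtain ⟨y, hy, hvy⟩ := (hS _ hT).1 (by linarith) v hv
      exact ⟨y, hsub hy, hvy⟩
    · intro hd
      have hbS' : b ∈ S := by
        obtain ⟨y, hy, hay⟩ := hd a (by simp)
        rcases hmem y hy with rfl | rfl | hyT
        · exact absurd hay (G.loopless.irrefl _)
        · exact hy
        · exact absurd hay (hna y (hT hyT))
      have haS : a ∈ S := by
        obtain ⟨y, hy, hby⟩ := hd b (by simp)
        rcases hmem y hy with rfl | rfl | hyT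
        · exact hy
        · exact absurd hby (G.loopless.irrefl _)
        · exact absurd hby (hnb y (hT hyT))
      have := (hS _ hT).2 fun v hv => by
        obtain ⟨y, hy, hvy⟩ := hd v (by simp [hv])
        rcases hmem y hy with rfl | rfl | hyT
        · exact absurd hvy.symm (hna v hv)
        · exact absurd hvy.symm (hnb v hv)
        · exact ⟨y, hyT, hvy⟩
      rw [if_pos haS, if_pos hbS']
      linarith

theorem EdgeThreshold.totalDomThreshold {V : Type*} {G : SimpleGraph V} {A : Finset V}
    (h : EdgeThreshold G A) : TotalDomThreshold G A := by
  classical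
  induction h with
  | empty =>
    refine ⟨fun _ => 1, 0, by simp, le_rfl, fun S hS => ?_⟩
    simp [Finset.subset_empty.1 hS]
  | isolated hv h hA ih =>
    convert totalDomThreshold_of_isolated (Finset.mem_insert_self _ _) _ using 1
    simpa using h
  | @universal A v hv h hA ih =>
    rcases A.eq_empty_or_nonempty with rfl | hne
    · exact totalDomThreshold_of_isolated (v := v) (by simp) (by simp)
    · convert ih.insert_universal hne hv h using 1
  | edge ha hb hab hna hnb hA ih =>
    convert ih.insert_edge ha hb hab hna hnb using 1

theorem NeighborhoodThreshold.subset {V : Type*} {G : SimpleGraph V} {A B : Finset V}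
    (h : NeighborhoodThreshold G A) (hBA : B ⊆ A) (hne : B.Nonempty)
    (hB : ∀ v ∈ A, v ∉ B → ∀ x ∈ B, ¬ G.Adj v x) : NeighborhoodThreshold G B := by
  obtain ⟨w, t, hS⟩ := h
  refine ⟨w, t, fun S hSB => ?_⟩
  rw [hS S (hSB.trans hBA)]
  refine ⟨fun ⟨v, hv, hvS⟩ => ?_, fun ⟨v, hv, hvS⟩ => ⟨v, hBA hv, hvS⟩⟩
  by_cases hvB : v ∈ B
  · exact ⟨v, hvB, hvS⟩
  · obtain ⟨b, hb⟩ := hne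
    exact ⟨b, hb, fun x hx => absurd (hvS x hx) (hB v hv hvB x (hSB hx))⟩

theorem NeighborhoodThreshold.erase_universal {V : Type*} [DecidableEq V] {G : SimpleGraph V}
    {A : Finset V} {u : V} (h : NeighborhoodThreshold G A) (hu : u ∈ A)
    (hadj : ∀ x ∈ A, x ≠ u → G.Adj u x) : NeighborhoodThreshold G (A.erase u) := by
  obtain ⟨w, t, hS⟩ := h
  refine ⟨w, t - w u, fun S hSB => ?_⟩
  have huS : u ∉ S := fun hc => by simpa using hSB hc
  have := hS (insert u S) (Finset.insert_subset hu (hSB.trans (Finset.erase_subset _ _)))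
  rw [Finset.sum_insert huS] at this
  rw [lt_sub_iff_add_lt', this]
  constructor
  · rintro ⟨v, hv, hvS⟩
    exact ⟨v, Finset.mem_erase.2 ⟨(hvS u (by simp)).ne, hv⟩,
      fun x hx => hvS x (Finset.mem_insert_of_mem hx)⟩
  · rintro ⟨v, hv, hvS⟩
    obtain ⟨hvu, hvA⟩ := Finset.mem_erase.1 hv
    refine ⟨v, hvA, fun x hx => ?_⟩
    rcases Finset.mem_insert.1 hx with rfl | hx
    · exact (hadj v hvA hvu).symm
    · exact hvS x hx

/-- A nonempty induced graph with threshold neighborhoods has an isolated vertex, a universal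
vertex or an isolated edge. -/
theorem NeighborhoodThreshold.exists_isolated_or_universal_or_edge {V : Type*}
    {G : SimpleGraph V} {A : Finset V} (h : NeighborhoodThreshold G A) (hne : A.Nonempty) :
    (∃ u ∈ A, ∀ x ∈ A, ¬ G.Adj u x) ∨ (∃ u ∈ A, ∀ x ∈ A, x ≠ u → G.Adj u x) ∨
      ∃ a ∈ A, ∃ b ∈ A, G.Adj a b ∧ (∀ x ∈ A, G.Adj a x → x = b) ∧
        ∀ x ∈ A, G.Adj b x → x = a := by
  classical
  obtain ⟨w, t, hS⟩ := h
  by_contra! hcon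
  obtain ⟨hiso, huni, hedge⟩ := hcon
  obtain ⟨u, hu, hmax⟩ := Finset.exists_max_image A w hne
  have pair : ∀ x ∈ A, ∀ y ∈ A, x ≠ y →
      (w x + w y < t ↔ ∃ v ∈ A, G.Adj v x ∧ G.Adj v y) := by
    intro x hx y hy hxy
    have := hS {x, y} (by simp [Finset.insert_subset_iff, hx, hy])
    simpa [Finset.sum_pair hxy] using this
  -- A vertex of maximum weight dominates its connected component.
  have hdom : ∀ v ∈ A, G.Adj u v → ∀ x ∈ A, G.Adj v x → x ≠ u → G.Adj u x := by
    intro v hv huv x hx hvx hxu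
    let N := A.filter (G.Adj v)
    have huN : u ∈ N := by simp [N, hu, huv.symm]
    have hNA : N ⊆ A := Finset.filter_subset _ _
    have hN : ∑ x ∈ N, w x < t := (hS N hNA).2 ⟨v, hv, by simp [N]⟩
    have hvN : v ∉ N.erase u := by simp [N]
    have hlt : ∑ x ∈ insert v (N.erase u), w x < t := by
      rw [Finset.sum_insert hvN]
      have := Finset.add_sum_erase N w huN
      linarith [hmax v hv]
    obtain ⟨z, hz, hzS⟩ := (hS _ (Finset.insert_subset hv
      ((Finset.erase_subset _ _).trans hNA))).1 hlt
    have hzu : z = u := by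
      by_contra hzu
      refine G.loopless.irrefl z (hzS z ?_)
      simp [N, hz, hzu, (hzS v (by simp)).symm]
    subst hzu
    exact hzS x (by simp [N, hx, hxu, hvx])
  obtain ⟨l, hl, hul⟩ := hiso u hu
  obtain ⟨y, hy, hyu, hnuy⟩ := huni u hu
  by_cases hL : ∀ x ∈ A, G.Adj u x → x = l
  · obtain ⟨x, hx, hlx, hxu⟩ := hedge u hu l hl hul hL
    have hxl := hL x hx (hdom l hl hul x hx hlx hxu)
    exact hlx.ne hxl.symm
  push Not at hL
  obtain ⟨l', hl', hul', hne'⟩ := hL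
  have hlt : w l + w l' < t := (pair l hl l' hl' hne'.symm).2 ⟨u, hu, hul, hul'⟩
  have hfar : ∀ p ∈ A, ¬ G.Adj u p → p ≠ u → ∀ q ∈ A, G.Adj u q → t ≤ w q + w p := by
    intro p hp hup hpu q hq huq
    have hqp : q ≠ p := fun hc => hup (hc ▸ huq)
    by_contra! hsum
    obtain ⟨z, hz, hzq, hzp⟩ := (pair q hq p hp hqp).1 hsum
    by_cases hzu : z = u
    · exact hup (hzu ▸ hzp)
    · exact hup (hdom z hz (hdom q hq huq z hz hzq.symm hzu) p hp hzp hpu)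
  have hleave : ∀ p ∈ A, ¬ G.Adj u p → p ≠ u → ∀ q ∈ A, G.Adj p q → ¬ G.Adj u q ∧ q ≠ u := by
    intro p hp hup hpu q hq hpq
    refine ⟨fun huq => hup (hdom q hq huq p hp hpq.symm hpu), ?_⟩
    rintro rfl
    exact hup hpq.symm
  have huniq : ∀ p ∈ A, ¬ G.Adj u p → p ≠ u → ∀ q ∈ A, G.Adj p q → ∀ r ∈ A, G.Adj p r →
      r = q := by
    intro p hp hup hpu q hq hpq r hr hpr
    by_contra hrq
    obtain ⟨hq1, hq2⟩ := hleave p hp hup hpu q hq hpq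
    obtain ⟨hr1, hr2⟩ := hleave p hp hup hpu r hr hpr
    have h1 := hfar q hq hq1 hq2 l hl hul
    have h2 := hfar r hr hr1 hr2 l' hl' hul'
    have h3 := (pair r hr q hq hrq).2 ⟨p, hp, hpr, hpq⟩
    linarith
  obtain ⟨y', hy', hyy'⟩ := hiso y hy
  have hy'u := hleave y hy hnuy hyu y' hy' hyy'
  obtain ⟨x, hx, hyx, hxy⟩ := hedge y hy y' hy' hyy' (huniq y hy hnuy hyu y' hy' hyy')
  exact hxy (huniq y' hy' hy'u.1 hy'u.2 y hy hyy'.symm x hx hyx)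

theorem NeighborhoodThreshold.edgeThreshold {V : Type*} {G : SimpleGraph V} {A : Finset V}
    (h : NeighborhoodThreshold G A) : EdgeThreshold G A := by
  classical
  induction A using Finset.strongInduction with
  | H A ih =>
    have restrict : ∀ B ⊂ A, (∀ v ∈ A, v ∉ B → ∀ x ∈ B, ¬ G.Adj v x) → EdgeThreshold G B := by
      intro B hBA hB
      rcases B.eq_empty_or_nonempty with rfl | hne
      · exact .empty
      · exact ih B hBA (h.subset hBA.subset hne hB)
    rcases A.eq_empty_or_nonempty with rfl | hne
    · exact .empty
    rcases h.exists_isolated_or_universal_or_edge hne with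
      ⟨u, hu, hadj⟩ | ⟨u, hu, hadj⟩ | ⟨a, ha, b, hb, hab, hna, hnb⟩
    · have := EdgeThreshold.isolated (A := A.erase u) (v := u) (by simp)
        (fun x hx => hadj x (Finset.mem_of_mem_erase hx))
        (restrict _ (Finset.erase_ssubset hu) fun v hv hvu x hx => by
          obtain rfl : v = u := by simpa [hv] using hvu
          exact hadj x (Finset.mem_of_mem_erase hx))
      convert this
      rw [Finset.insert_erase hu]
    · have := EdgeThreshold.universal (A := A.erase u) (v := u) (by simp)
        (fun x hx => hadj x (Finset.mem_of_mem_erase hx) (Finset.ne_of_mem_erase hx))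
        (ih _ (Finset.erase_ssubset hu) (h.erase_universal hu hadj))
      convert this
      rw [Finset.insert_erase hu]
    · have hna' : ∀ x ∈ (A.erase a).erase b, ¬ G.Adj a x := by
        intro x hx hax
        simp only [Finset.mem_erase] at hx
        exact hx.1 (hna x hx.2.2 hax)
      have hnb' : ∀ x ∈ (A.erase a).erase b, ¬ G.Adj b x := by
        intro x hx hbx
        simp only [Finset.mem_erase] at hx
        exact hx.2.1 (hnb x hx.2.2 hbx)
      have := EdgeThreshold.edge (A := (A.erase a).erase b) (by simp) (by simp) hab hna' hnb'
        (restrict _ ((Finset.erase_subset _ _).trans_ssubset (Finset.erase_ssubset ha))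
          fun v hv hvB => by
            have : v = a ∨ v = b := by
              simp only [Finset.mem_erase] at hvB
              tauto
            rcases this with rfl | rfl
            · exact hna'
            · exact hnb')
      convert this
      rw [Finset.insert_erase (Finset.mem_erase.2 ⟨hab.ne', hb⟩), Finset.insert_erase ha]

theorem Domishold.neighborhoodThreshold {V : Type*} [Fintype V] {G : SimpleGraph V}
    (h : Domishold Gᶜ) : NeighborhoodThreshold G Finset.univ := by
  obtain ⟨w, t, hS⟩ := h
  refine ⟨fun x => w x, t, fun S _ => ?_⟩
  rw [← NNReal.coe_sum, NNReal.coe_lt_coe, ← not_le, hS S]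
  simp only [DomSet, SimpleGraph.compl_adj]
  push Not
  constructor
  · rintro ⟨v, hv, hvS⟩
    exact ⟨v, Finset.mem_univ _, fun x hx => hvS x hx (by rintro rfl; exact hv hx)⟩
  · rintro ⟨v, -, hvS⟩
    exact ⟨v, fun hv => G.loopless.irrefl v (hvS v hv), fun x hx _ => hvS x hx⟩

theorem TotalDomThreshold.totalDomishold_induce {V : Type*} {G : SimpleGraph V} {A : Finset V}
    (h : TotalDomThreshold G A) : TotalDomishold (G.induce (↑A : Set V)) := by
  obtain ⟨w, t, hw, ht, hS⟩ := h
  refine ⟨fun x => (w x).toNNReal, t.toNNReal, fun S => ?_⟩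
  have := hS (S.map (Function.Embedding.subtype _)) (by
    intro x hx
    obtain ⟨y, -, rfl⟩ := Finset.mem_map.1 hx
    exact y.2)
  rw [Finset.sum_map] at this
  rw [← NNReal.coe_le_coe, NNReal.coe_sum]
  simpa [TotalDomSet, ht, (hw _).le] using this

/-- Every co-domishold graph (a graph whose complement is domishold) is hereditary
total domishold. -/
theorem stmt_6 {V : Type*} [Fintype V] (G : SimpleGraph V) (h : Domishold Gᶜ) :
    HereditaryTD G := by
  intro A
  exact (h.neighborhoodThreshold.edgeThreshold.mono
    (Finset.subset_univ A)).totalDomThreshold.totalDomishold_induce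
end

section
/- For every finite simple graph G there exists a total domishold finite simple graph G' without isolated vertices such that G is isomorphic to an induced subgraph of G'. -/
open Classical in
/-- If every vertex has a neighbor that is the unique neighbor of some vertex, then the total
dominating sets are exactly the supersets of the set of unique neighbors, so the graph is total
domishold. -/
theorem TotalDomishold.of_unique_neighbors {V : Type*} [Fintype V] (G : SimpleGraph V)
    (h : ∀ v, ∃ u, G.Adj v u ∧ ∃ y, ∀ z, G.Adj y z ↔ z = u) : TotalDomishold G := by
  let F : Finset V := {u | ∃ y, ∀ z, G.Adj y z ↔ z = u}
  refine ⟨fun x => if x ∈ F then 1 else 0, F.card, fun S => ?_⟩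
  have hsum : ∑ x ∈ S, (if x ∈ F then (1 : NNReal) else 0) = ((S ∩ F).card : NNReal) := by
    rw [Finset.sum_boole, Finset.filter_mem_eq_inter]
  rw [hsum, Nat.cast_le]
  constructor
  · intro hle v
    have hF : S ∩ F = F := Finset.eq_of_subset_of_card_le Finset.inter_subset_right hle
    obtain ⟨u, huv, hu⟩ := h v
    exact ⟨u, Finset.inter_eq_right.mp hF (by simpa [F] using hu), huv⟩
  · intro hS
    refine Finset.card_le_card fun u hu => Finset.mem_inter.mpr ⟨?_, hu⟩
    obtain ⟨y, hy⟩ : ∃ y, ∀ z, G.Adj y z ↔ z = u := by simpa [F] using hu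
    obtain ⟨z, hz, hyz⟩ := hS y
    exact (hy z).mp hyz ▸ hz

/-- The graph obtained from `G` by attaching a pendant vertex to every vertex. -/
def SimpleGraph.withPendants {V : Type*} (G : SimpleGraph V) : SimpleGraph (V ⊕ V) where
  Adj
    | .inl u, .inl v => G.Adj u v
    | .inl u, .inr v => u = v
    | .inr u, .inl v => u = v
    | .inr _, .inr _ => False
  symm := ⟨by
    rintro (u | u) (v | v) h
    exacts [G.adj_symm h, h.symm, h.symm, h]⟩
  loopless := ⟨by
    rintro (u | u) h
    exacts [G.irrefl h, h]⟩

theorem SimpleGraph.withPendants_unique_neighbors {V : Type*} (G : SimpleGraph V) (x : V ⊕ V) :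
    ∃ u, G.withPendants.Adj x u ∧ ∃ y, ∀ z, G.withPendants.Adj y z ↔ z = u := by
  have hinl (v : V) : ∃ y, ∀ z, G.withPendants.Adj y z ↔ z = .inl v :=
    ⟨.inr v, by rintro (z | z) <;> simp [withPendants, eq_comm]⟩
  rcases x with v | v
  · by_cases hv : ∃ u, G.Adj v u
    · obtain ⟨u, hu⟩ := hv
      exact ⟨.inl u, hu, hinl u⟩
    · push Not at hv
      refine ⟨.inr v, rfl, .inl v, ?_⟩
      rintro (z | z) <;> simp [withPendants, hv, eq_comm]
  · exact ⟨.inl v, rfl, hinl v⟩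

/-- Every graph is an induced subgraph of a total domishold graph without isolated vertices. -/
theorem stmt_7 {V : Type} [Fintype V] (G : SimpleGraph V) :
    ∃ (W : Type) (inst : Fintype W) (G' : SimpleGraph W),
      @TotalDomishold W inst G' ∧ (∀ v : W, ∃ u : W, G'.Adj v u) ∧ Nonempty (G ↪g G') :=
  ⟨V ⊕ V, inferInstance, G.withPendants,
    TotalDomishold.of_unique_neighbors _ G.withPendants_unique_neighbors,
    fun v => (G.withPendants_unique_neighbors v).imp fun _ h => h.1,
    ⟨⟨Function.Embedding.inl, Iff.rfl⟩⟩⟩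
end

section
/- Every total domishold finite simple graph G is 2-asummable; that is, there do not exist subsets A₁, A₂, B₁, B₂ of V(G) (not necessarily distinct) such that each A_i contains the neighborhood N_G(v) of some vertex v, neither B₁ nor B₂ contains the neighborhood of any vertex, and for every vertex v ∈ V(G) the number of indices i ∈ {1,2} with v ∈ A_i equals the number of indices i ∈ {1,2} with v ∈ B_i. -/
/-- The complement of a set containing a neighborhood is not total dominating. -/
theorem not_totalDomSet_compl {V : Type*} [Fintype V] [DecidableEq V] {G : SimpleGraph V}
    {A : Finset V} (hA : ∃ v, ∀ u, G.Adj v u → u ∈ A) : ¬ TotalDomSet G Aᶜ := by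
  obtain ⟨v, hv⟩ := hA
  intro hD
  obtain ⟨u, hu, huv⟩ := hD v
  exact Finset.mem_compl.1 hu (hv u huv)

/-- The complement of a set containing no neighborhood is total dominating. -/
theorem totalDomSet_compl {V : Type*} [Fintype V] [DecidableEq V] {G : SimpleGraph V}
    {B : Finset V} (hB : ¬ ∃ v, ∀ u, G.Adj v u → u ∈ B) : TotalDomSet G Bᶜ := by
  intro v
  push Not at hB
  obtain ⟨u, huv, hu⟩ := hB v
  exact ⟨u, Finset.mem_compl.2 hu, huv⟩

/-- Every total domishold graph is 2-asummable: there are no sets `A₁, A₂` each containing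
the neighborhood of some vertex, and sets `B₁, B₂` containing the neighborhood of no vertex,
such that every vertex belongs to as many `Aᵢ`'s as `Bᵢ`'s. -/
theorem stmt_15 {V : Type*} [Fintype V] [DecidableEq V] (G : SimpleGraph V)
    (h : TotalDomishold G) :
    ¬ ∃ A₁ A₂ B₁ B₂ : Finset V,
      (∃ v : V, ∀ u : V, G.Adj v u → u ∈ A₁) ∧
      (∃ v : V, ∀ u : V, G.Adj v u → u ∈ A₂) ∧
      (¬ ∃ v : V, ∀ u : V, G.Adj v u → u ∈ B₁) ∧
      (¬ ∃ v : V, ∀ u : V, G.Adj v u → u ∈ B₂) ∧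
      (∀ v : V,
        ((if v ∈ A₁ then 1 else 0) + (if v ∈ A₂ then 1 else 0) : ℕ) =
        (if v ∈ B₁ then 1 else 0) + (if v ∈ B₂ then 1 else 0)) := by
  obtain ⟨w, t, hw⟩ := h
  rintro ⟨A₁, A₂, B₁, B₂, hA₁, hA₂, hB₁, hB₂, hAB⟩
  have hlt {A : Finset V} (hA : ∃ v, ∀ u, G.Adj v u → u ∈ A) : ∑ x ∈ Aᶜ, w x < t :=
    not_le.1 fun hle => not_totalDomSet_compl hA ((hw _).1 hle)
  have hle {B : Finset V} (hB : ¬ ∃ v, ∀ u, G.Adj v u → u ∈ B) : t ≤ ∑ x ∈ Bᶜ, w x :=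
    (hw _).2 (totalDomSet_compl hB)
  have hsum : ∑ x ∈ A₁ᶜ, w x + ∑ x ∈ A₂ᶜ, w x = ∑ x ∈ B₁ᶜ, w x + ∑ x ∈ B₂ᶜ, w x := by
    have key (S T : Finset V) : ∑ x ∈ Sᶜ, w x + ∑ x ∈ Tᶜ, w x =
        ∑ x, ((if x ∈ Sᶜ then w x else 0) + if x ∈ Tᶜ then w x else 0) := by
      simp only [Finset.sum_add_distrib, Finset.sum_ite_mem, Finset.univ_inter]
    rw [key, key]
    refine Finset.sum_congr rfl fun x _ => ?_
    have hx := hAB x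
    simp only [Finset.mem_compl]
    split_ifs at hx ⊢ <;> simp_all
  exact (add_lt_add (hlt hA₁) (hlt hA₂)).not_ge (hsum ▸ add_le_add (hle hB₁) (hle hB₂))
end

section
/- Every hereditary total domishold finite simple graph G is a (1,2)-polar chordal graph; that is, V(G) admits a partition into two (possibly empty) parts K and L such that K is a clique of G and the subgraph of G induced by L has maximum degree at most 1, and moreover G contains no induced cycle of length at least 4 (for every n ≥ 4 there is no induced-subgraph embedding of the cycle Cₙ into G). -/
/-- Total domisholdness of `G.induce A`, phrased with subsets of `A`. -/
theorem HereditaryTD.exists_weight {V : Type*} [Fintype V] [DecidableEq V] {G : SimpleGraph V}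
    (h : HereditaryTD G) (A : Finset V) :
    ∃ (w : V → NNReal) (t : NNReal), ∀ S ⊆ A,
      (t ≤ ∑ x ∈ S, w x ↔ ∀ v ∈ A, ∃ u ∈ S, G.Adj v u) := by
  obtain ⟨w, t, hw⟩ := h A
  refine ⟨fun x => if hx : x ∈ A then w ⟨x, hx⟩ else 0, t, fun S hS => ?_⟩
  have key := hw (S.subtype (· ∈ (↑A : Set V)))
  have hsum : ∑ x ∈ S.subtype (· ∈ (↑A : Set V)), w x
      = ∑ x ∈ S, if hx : x ∈ A then w ⟨x, hx⟩ else 0 := by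
    have := Finset.sum_subtype_of_mem (s := S) (p := (· ∈ (↑A : Set V)))
      (fun x => if hx : x ∈ A then w ⟨x, hx⟩ else 0) (fun x hx => hS hx)
    rw [← this]
    refine Finset.sum_congr rfl fun x _ => ?_
    have hx : (x : V) ∈ A := x.2
    simp [hx]
  rw [hsum] at key
  rw [key]
  constructor
  · intro hD v hv
    obtain ⟨u, hu, huv⟩ := hD ⟨v, hv⟩
    exact ⟨u, by simpa using hu, huv⟩
  · rintro hD ⟨v, hv⟩
    obtain ⟨u, hu, huv⟩ := hD v hv
    exact ⟨⟨u, hS hu⟩, by simpa using hu, huv⟩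

/-- If `{a, b}` and `{c, d}` contain neighborhoods within `A` but neither `{a, c}` nor `{b, d}`
does, then `G.induce A` is not total domishold. -/
theorem HereditaryTD.false_of_exchange {V : Type*} [Fintype V] [DecidableEq V]
    {G : SimpleGraph V} (h : HereditaryTD G) (A : Finset V) {p q a b c d : V}
    (hp : p ∈ A) (hq : q ∈ A) (ha : a ∈ A) (hb : b ∈ A) (hc : c ∈ A) (hd : d ∈ A)
    (hab : a ≠ b) (hcd : c ≠ d) (hac : a ≠ c) (hbd : b ≠ d)
    (hpN : ∀ u ∈ A, G.Adj p u → u = a ∨ u = b) (hqN : ∀ u ∈ A, G.Adj q u → u = c ∨ u = d)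
    (h₁ : ∀ v ∈ A, ∃ u ∈ A, u ≠ a ∧ u ≠ c ∧ G.Adj v u)
    (h₂ : ∀ v ∈ A, ∃ u ∈ A, u ≠ b ∧ u ≠ d ∧ G.Adj v u) : False := by
  obtain ⟨w, t, hw⟩ := h.exists_weight A
  have hsum : ∀ x y, x ∈ A → y ∈ A → x ≠ y →
      ∑ z ∈ A, w z = ∑ z ∈ A \ {x, y}, w z + (w x + w y) := by
    intro x y hx hy hxy
    rw [← Finset.sum_pair hxy, Finset.sum_sdiff]
    simp [Finset.insert_subset_iff, hx, hy]
  have n₁ : ¬ t ≤ ∑ z ∈ A \ {a, b}, w z := by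
    rw [hw _ Finset.sdiff_subset]
    intro H
    obtain ⟨u, hu, hpu⟩ := H p hp
    have := hpN u (by simp_all) hpu
    simp_all
  have n₂ : ¬ t ≤ ∑ z ∈ A \ {c, d}, w z := by
    rw [hw _ Finset.sdiff_subset]
    intro H
    obtain ⟨u, hu, hqu⟩ := H q hq
    have := hqN u (by simp_all) hqu
    simp_all
  have y₁ : t ≤ ∑ z ∈ A \ {a, c}, w z := by
    rw [hw _ Finset.sdiff_subset]
    intro v hv
    obtain ⟨u, hu, hua, huc, hvu⟩ := h₁ v hv
    exact ⟨u, by simp_all, hvu⟩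
  have y₂ : t ≤ ∑ z ∈ A \ {b, d}, w z := by
    rw [hw _ Finset.sdiff_subset]
    intro v hv
    obtain ⟨u, hu, hub, hud, hvu⟩ := h₂ v hv
    exact ⟨u, by simp_all, hvu⟩
  have e₁ := hsum a b ha hb hab
  have e₂ := hsum c d hc hd hcd
  have e₃ := hsum a c ha hc hac
  have e₄ := hsum b d hb hd hbd
  push Not at n₁ n₂
  rw [← NNReal.coe_lt_coe] at n₁ n₂
  rw [← NNReal.coe_le_coe] at y₁ y₂
  rw [← NNReal.coe_inj] at e₁ e₂ e₃ e₄
  simp only [NNReal.coe_add] at e₁ e₂ e₃ e₄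
  linarith

theorem HereditaryTD.isEmpty_cycleGraph_embedding {V : Type*} [Fintype V] [DecidableEq V]
    {G : SimpleGraph V} (h : HereditaryTD G) {n : ℕ} (hn : 4 ≤ n) :
    IsEmpty (SimpleGraph.cycleGraph n ↪g G) := by
  obtain ⟨m, rfl⟩ : ∃ m, n = m + 4 := ⟨n - 4, by omega⟩
  refine ⟨fun f => ?_⟩
  have hadj : ∀ i j : Fin (m + 4), G.Adj (f i) (f j) ↔ i - j = 1 ∨ j - i = 1 := fun i j => by
    rw [f.map_adj_iff, SimpleGraph.cycleGraph_adj]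
  have hne : ∀ i j : Fin (m + 4), i ≠ j → f i ≠ f j := fun i j hij => f.injective.ne hij
  have h2 : 2 % (m + 4) = 2 := Nat.mod_eq_of_lt (by omega)
  have h3 : 3 % (m + 4) = 3 := Nat.mod_eq_of_lt (by omega)
  have c₂ : (2 : Fin (m + 4)) ≠ 0 := by simp [Fin.ext_iff, h2]
  have c₃ : (3 : Fin (m + 4)) ≠ 0 := by simp [Fin.ext_iff, h3]
  have d₁ : (0 : Fin (m + 4)) ≠ 1 := by simp
  have d₂ : (1 : Fin (m + 4)) ≠ 3 := by simp [Fin.ext_iff, h3]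
  have d₃ : (2 : Fin (m + 4)) ≠ 3 := by simp [Fin.ext_iff, h2, h3]
  refine h.false_of_exchange (Finset.univ.image f) (p := f 1) (q := f 2) (a := f 0) (b := f 2)
    (c := f 1) (d := f 3) (by simp) (by simp) (by simp) (by simp) (by simp) (by simp)
    (hne _ _ c₂.symm) (hne _ _ d₂) (hne _ _ d₁) (hne _ _ d₃) ?_ ?_ ?_ ?_
  · simp only [Finset.mem_image, Finset.mem_univ, true_and, forall_exists_index,
      forall_apply_eq_imp_iff, hadj, f.injective.eq_iff]
    grind
  · simp only [Finset.mem_image, Finset.mem_univ, true_and, forall_exists_index,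
      forall_apply_eq_imp_iff, hadj, f.injective.eq_iff]
    grind
  · simp only [Finset.mem_image, Finset.mem_univ, true_and, forall_exists_index,
      forall_apply_eq_imp_iff, exists_exists_eq_and, hadj, ne_eq, f.injective.eq_iff]
    intro i
    by_cases hi : i + 1 = 0 ∨ i + 1 = 1
    · exact ⟨i - 1, by grind⟩
    · exact ⟨i + 1, by grind⟩
  · simp only [Finset.mem_image, Finset.mem_univ, true_and, forall_exists_index,
      forall_apply_eq_imp_iff, exists_exists_eq_and, hadj, ne_eq, f.injective.eq_iff]
    intro i
    by_cases hi : i + 1 = 2 ∨ i + 1 = 3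
    · exact ⟨i - 1, by grind⟩
    · exact ⟨i + 1, by grind⟩

theorem HereditaryTD.false_of_induced_four_cycle {V : Type*} [Fintype V] [DecidableEq V]
    {G : SimpleGraph V} (h : HereditaryTD G) {a b c d : V} (hab : G.Adj a b) (hbc : G.Adj b c)
    (hcd : G.Adj c d) (hda : G.Adj d a) (hac : ¬ G.Adj a c) (hbd : ¬ G.Adj b d)
    (nac : a ≠ c) (nbd : b ≠ d) : False := by
  have := G.adj_comm
  have := hab.ne
  have := hbc.ne
  have := hcd.ne
  have := hda.ne
  refine h.false_of_exchange {a, b, c, d} (p := b) (q := c) (a := a) (b := c) (c := b) (d := d)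
    (by simp) (by simp) (by simp) (by simp) (by simp) (by simp) nac nbd (by grind) (by grind)
    ?_ ?_ ?_ ?_
  · have := G.irrefl (v := b); grind
  · have := G.irrefl (v := c); grind
  · simp only [Finset.mem_insert, Finset.mem_singleton, forall_eq_or_imp, forall_eq]
    exact ⟨⟨d, by grind⟩, ⟨c, by grind⟩, ⟨d, by grind⟩, ⟨c, by grind⟩⟩
  · simp only [Finset.mem_insert, Finset.mem_singleton, forall_eq_or_imp, forall_eq]
    exact ⟨⟨b, by grind⟩, ⟨a, by grind⟩, ⟨b, by grind⟩, ⟨a, by grind⟩⟩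

theorem HereditaryTD.false_of_induced_five_cycle {V : Type*} [Fintype V] [DecidableEq V]
    {G : SimpleGraph V} (h : HereditaryTD G) {a b c d e : V} (hab : G.Adj a b)
    (hbc : G.Adj b c) (hcd : G.Adj c d) (hde : G.Adj d e) (hea : G.Adj e a)
    (hac : ¬ G.Adj a c) (had : ¬ G.Adj a d) (hbd : ¬ G.Adj b d) (hbe : ¬ G.Adj b e)
    (hce : ¬ G.Adj c e) : False := by
  have := G.adj_comm
  have := hab.ne
  have := hbc.ne
  have := hcd.ne
  have := hde.ne
  have := hea.ne
  have : a ≠ c := by grind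
  have : a ≠ d := by grind
  have : b ≠ d := by grind
  have : b ≠ e := by grind
  have : c ≠ e := by grind
  refine h.false_of_exchange {a, b, c, d, e} (p := b) (q := c) (a := a) (b := c) (c := b)
    (d := d) (by simp) (by simp) (by simp) (by simp) (by simp) (by simp) (by grind) (by grind)
    (by grind) (by grind) ?_ ?_ ?_ ?_
  · have := G.irrefl (v := b); grind
  · have := G.irrefl (v := c); grind
  · simp only [Finset.mem_insert, Finset.mem_singleton, forall_eq_or_imp, forall_eq]
    exact ⟨⟨e, by grind⟩, ⟨c, by grind⟩, ⟨d, by grind⟩, ⟨c, by grind⟩, ⟨d, by grind⟩⟩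
  · simp only [Finset.mem_insert, Finset.mem_singleton, forall_eq_or_imp, forall_eq]
    exact ⟨⟨b, by grind⟩, ⟨a, by grind⟩, ⟨b, by grind⟩, ⟨e, by grind⟩, ⟨a, by grind⟩⟩

/-- Of two nonadjacent vertices, one has at most one private neighbor. -/
theorem HereditaryTD.eq_of_private_neighbors {V : Type*} [Fintype V] [DecidableEq V]
    {G : SimpleGraph V} (h : HereditaryTD G) {p q a b c d : V} (hpq : ¬ G.Adj p q)
    (hab : a ≠ b) (hpa : G.Adj p a) (hpb : G.Adj p b) (hqa : ¬ G.Adj q a) (hqb : ¬ G.Adj q b)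
    (hqc : G.Adj q c) (hqd : G.Adj q d) (hpc : ¬ G.Adj p c) (hpd : ¬ G.Adj p d) : c = d := by
  by_contra hcd
  have := G.adj_comm
  have := G.irrefl (v := p)
  have := G.irrefl (v := q)
  refine h.false_of_exchange {p, q, a, b, c, d} (p := p) (q := q) (a := a) (b := b) (c := c)
    (d := d) (by simp) (by simp) (by simp) (by simp) (by simp) (by simp) hab hcd (by grind)
    (by grind) (by grind) (by grind) ?_ ?_
  · simp only [Finset.mem_insert, Finset.mem_singleton, forall_eq_or_imp, forall_eq]
    exact ⟨⟨b, by grind⟩, ⟨d, by grind⟩, ⟨p, by grind⟩, ⟨p, by grind⟩, ⟨q, by grind⟩,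
      ⟨q, by grind⟩⟩
  · simp only [Finset.mem_insert, Finset.mem_singleton, forall_eq_or_imp, forall_eq]
    exact ⟨⟨a, by grind⟩, ⟨c, by grind⟩, ⟨p, by grind⟩, ⟨p, by grind⟩, ⟨q, by grind⟩,
      ⟨q, by grind⟩⟩

namespace SimpleGraph

variable {V : Type*} [DecidableEq V] (G : SimpleGraph V) [DecidableRel G.Adj]

/-- The number of darts of `G` with both ends in `L`. -/
def dartsWithin (L : Finset V) : ℕ := ∑ u ∈ L, (L.filter (fun v => G.Adj u v)).card

theorem dartsWithin_insert {L : Finset V} {x : V} (hx : x ∉ L) :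
    G.dartsWithin (insert x L) =
      G.dartsWithin L + 2 * (L.filter (fun v => G.Adj x v)).card := by
  have h₁ : ∀ u, ((insert x L).filter (fun v => G.Adj u v)).card =
      (L.filter (fun v => G.Adj u v)).card + if G.Adj u x then 1 else 0 := by
    intro u
    rw [Finset.filter_insert]
    split_ifs <;> simp [hx]
  have h₂ : ∑ u ∈ L, (if G.Adj u x then 1 else 0) = (L.filter (fun v => G.Adj x v)).card := by
    rw [Finset.card_filter]
    simp only [G.adj_comm x]
  simp only [dartsWithin, Finset.sum_insert hx, h₁, Finset.sum_add_distrib, h₂]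
  simp
  omega

theorem dartsWithin_erase_add {L : Finset V} {x : V} (hx : x ∈ L) :
    G.dartsWithin (L.erase x) + 2 * (L.filter (fun v => G.Adj x v)).card = G.dartsWithin L := by
  conv_rhs => rw [← Finset.insert_erase hx, G.dartsWithin_insert (Finset.notMem_erase x L)]
  congr 3
  ext v
  simp only [Finset.mem_filter, Finset.mem_erase]
  have := G.irrefl (v := x)
  grind

theorem dartsWithin_insert_erase_add {L : Finset V} {x y : V} (hx : x ∈ L) (hy : y ∉ L) :
    G.dartsWithin (insert y (L.erase x)) + 2 * (L.filter (fun v => G.Adj x v)).card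
      ≤ G.dartsWithin L + 2 * (L.filter (fun v => G.Adj y v)).card := by
  have h₁ := G.dartsWithin_erase_add hx
  have h₂ := G.dartsWithin_insert (L := L.erase x) (x := y) (by simp [hy])
  have h₃ : ((L.erase x).filter (fun v => G.Adj y v)).card ≤
      (L.filter (fun v => G.Adj y v)).card :=
    Finset.card_le_card (Finset.filter_subset_filter _ (Finset.erase_subset _ _))
  omega

end SimpleGraph

/-- `L` has the fewest internal edges among the complements of cliques. -/
structure IsMinCocliqueSide {V : Type*} [DecidableEq V] (G : SimpleGraph V)
    [DecidableRel G.Adj] (L : Finset V) : Prop where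
  adj : ∀ u ∉ L, ∀ v ∉ L, u ≠ v → G.Adj u v
  min : ∀ L' : Finset V, (∀ u ∉ L', ∀ v ∉ L', u ≠ v → G.Adj u v) →
    G.dartsWithin L ≤ G.dartsWithin L'

namespace IsMinCocliqueSide

variable {V : Type*} [DecidableEq V] {G : SimpleGraph V} [DecidableRel G.Adj]
  {L : Finset V}

theorem exists_not_adj (m : IsMinCocliqueSide G L) {x y : V} (hx : x ∈ L) (hy : y ∈ L)
    (hxy : G.Adj x y) : ∃ k ∉ L, ¬ G.Adj x k := by
  by_contra! H
  have h₁ := m.min (L.erase x) (by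
    have := m.adj
    have := G.adj_comm
    simp only [Finset.mem_erase]
    grind)
  have h₂ := G.dartsWithin_erase_add hx
  have h₃ : 0 < (L.filter (fun v => G.Adj x v)).card :=
    Finset.card_pos.2 ⟨y, by simp [hy, hxy]⟩
  omega

theorem card_le_of_swap (m : IsMinCocliqueSide G L) {x k : V} (hx : x ∈ L) (hk : k ∉ L)
    (hxN : ∀ j ∉ L, j ≠ k → G.Adj x j) :
    (L.filter (fun v => G.Adj x v)).card ≤ (L.filter (fun v => G.Adj k v)).card := by
  have h₁ := m.min (insert k (L.erase x)) (by
    have := m.adj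
    have := G.adj_comm
    simp only [Finset.mem_insert, Finset.mem_erase]
    grind)
  have h₂ := G.dartsWithin_insert_erase_add hx hk
  omega

variable [Fintype V]

/-- Adjacent vertices of `L` have nested neighborhoods in the clique. -/
theorem nested (h : HereditaryTD G) (m : IsMinCocliqueSide G L) {x y i j : V} (hx : x ∈ L)
    (hy : y ∈ L) (hxy : G.Adj x y) (hi : i ∉ L) (hj : j ∉ L) (hxi : G.Adj x i)
    (hyi : ¬ G.Adj y i) (hyj : G.Adj y j) : G.Adj x j := by
  by_contra hxj
  have hij : i ≠ j := by rintro rfl; exact hxj hxi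
  exact h.false_of_induced_four_cycle hxy hyj (m.adj j hj i hi hij.symm) hxi.symm hxj hyi
    (by rintro rfl; exact hj hx) (by rintro rfl; exact hi hy)

/-- A connected triple of `L` misses a common vertex of the clique. -/
theorem exists_common_not_adj (h : HereditaryTD G) (m : IsMinCocliqueSide G L) {v a b : V}
    (hv : v ∈ L) (ha : a ∈ L) (hb : b ∈ L) (hva : G.Adj v a) (hvb : G.Adj v b) :
    ∃ k ∉ L, ¬ G.Adj v k ∧ ¬ G.Adj a k ∧ ¬ G.Adj b k := by
  by_contra! H
  obtain ⟨i, hi, hai⟩ := m.exists_not_adj ha hv hva.symm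
  obtain ⟨j, hj, hbj⟩ := m.exists_not_adj hb hv hvb.symm
  obtain ⟨k, hk, hvk⟩ := m.exists_not_adj hv ha hva
  have nva := fun i j => nested h m (i := i) (j := j) hv ha hva
  have nav := fun i j => nested h m (i := i) (j := j) ha hv hva.symm
  have nvb := fun i j => nested h m (i := i) (j := j) hv hb hvb
  have nbv := fun i j => nested h m (i := i) (j := j) hb hv hvb.symm
  have nab := fun hab i j => nested h m (i := i) (j := j) ha hb hab
  have hvi : ¬ G.Adj v i := by grind
  have hvj : ¬ G.Adj v j := by grind
  have hbi : G.Adj b i := H i hi hvi hai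
  have haj : G.Adj a j := by
    by_contra haj
    exact hbj (H j hj hvj haj)
  have hab : ¬ G.Adj a b := fun hab => hai (nab hab j i hj hi haj hbj hbi)
  have hij : i ≠ j := by rintro rfl; exact hai haj
  exact h.false_of_induced_five_cycle hva.symm hvb hbi (m.adj i hi j hj hij) haj.symm hab hai
    hvi hvj hbj

/-- A vertex of `L` missing exactly one vertex of the clique has at most one neighbor in `L`. -/
theorem eq_of_adj_of_almost_complete (h : HereditaryTD G) (m : IsMinCocliqueSide G L)
    {v a b k : V} (hv : v ∈ L) (ha : a ∈ L) (hb : b ∈ L) (hva : G.Adj v a) (hvb : G.Adj v b)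
    (hk : k ∉ L) (hvk : ¬ G.Adj v k) (hvN : ∀ j ∉ L, j ≠ k → G.Adj v j) : a = b := by
  by_contra hab
  have h₁ := m.card_le_of_swap hv hk hvN
  have h₂ : 1 < (L.filter (fun u => G.Adj v u)).card :=
    Finset.one_lt_card.2 ⟨a, by simp [*], b, by simp [*], hab⟩
  obtain ⟨k', hk', hvk', hak', hbk'⟩ := exists_common_not_adj h m hv ha hb hva hvb
  obtain rfl : k' = k := by
    by_contra hne
    exact hvk' (hvN k' hk' hne)
  have h₃ : ∀ c ∈ L, G.Adj k' c → ¬ G.Adj v c := by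
    intro c hc hkc hvc
    obtain ⟨j, hj, hcj⟩ := m.exists_not_adj hc hv hvc.symm
    have hjk : j ≠ k' := by rintro rfl; exact hcj hkc.symm
    exact h.false_of_induced_four_cycle hvc hkc.symm (m.adj k' hk j hj hjk.symm)
      (hvN j hj hjk).symm hvk hcj (by rintro rfl; exact hk hv) (by rintro rfl; exact hj hc)
  obtain ⟨c, hc, d, hd, hcd⟩ := Finset.one_lt_card.1 (h₂.trans_le h₁)
  simp only [Finset.mem_filter] at hc hd
  exact hcd (h.eq_of_private_neighbors hvk hab hva hvb (fun e => hak' e.symm)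
    (fun e => hbk' e.symm) hc.2 hd.2 (h₃ c hc.1 hc.2) (h₃ d hd.1 hd.2))

/-- If `v`, `a`, `b` all miss `k` and `v` also misses `k'`, then so does `a`. -/
theorem not_adj_of_common_not_adj (h : HereditaryTD G) (m : IsMinCocliqueSide G L)
    {v a b k k' : V} (hv : v ∈ L) (ha : a ∈ L) (hva : G.Adj v a) (hvb : G.Adj v b)
    (hab : a ≠ b) (hk : k ∉ L) (hvk : ¬ G.Adj v k) (hak : ¬ G.Adj a k) (hbk : ¬ G.Adj b k)
    (hk' : k' ∉ L) (hkk' : k ≠ k') (hvk' : ¬ G.Adj v k') : ¬ G.Adj a k' := by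
  intro hak'
  have hpriv : ∀ x, G.Adj k x → ¬ G.Adj v x → x = k' := fun x hkx hvx =>
    h.eq_of_private_neighbors hvk hab hva hvb (fun e => hak e.symm) (fun e => hbk e.symm)
      hkx (m.adj k hk k' hk' hkk') hvx hvk'
  have haN : ∀ j ∉ L, j ≠ k → G.Adj a j := by
    intro j hj hjk
    by_cases hvj : G.Adj v j
    · exact nested h m ha hv hva.symm hk' hj hak' hvk' hvj
    · exact hpriv j (m.adj k hk j hj hjk.symm) hvj ▸ hak'
  have hdeg : ∀ u ∈ L, G.Adj a u → u = v := fun u hu hau =>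
    eq_of_adj_of_almost_complete h m ha hu hv hau hva.symm hk hak haN
  have h₁ := m.card_le_of_swap ha hk haN
  have h₂ : 0 < (L.filter (fun u => G.Adj a u)).card :=
    Finset.card_pos.2 ⟨v, by simp [hv, hva.symm]⟩
  obtain ⟨c, hc⟩ := Finset.card_pos.1 (h₂.trans_le h₁)
  obtain ⟨hc, hkc⟩ := Finset.mem_filter.1 hc
  have hvc : G.Adj v c := by
    by_contra hvc
    exact hk' (hpriv c hkc hvc ▸ hc)
  have hac : ¬ G.Adj a c := fun hac => hvc.ne (hdeg c hc hac).symm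
  have hca : c ≠ a := by rintro rfl; exact hak hkc.symm
  have hne : v ≠ k' := by rintro rfl; exact hk' hv
  by_cases hck' : G.Adj c k'
  · exact h.false_of_induced_four_cycle hva.symm hvc hck' hak'.symm hac hvk' hca.symm hne
  · exact h.false_of_induced_five_cycle hva.symm hvc hkc.symm (m.adj k hk k' hk' hkk')
      hak'.symm hac hak hvk hvk' hck'

theorem card_filter_adj_le_one (h : HereditaryTD G) (m : IsMinCocliqueSide G L) {v : V}
    (hv : v ∈ L) : (L.filter (fun u => G.Adj v u)).card ≤ 1 := by
  by_contra! hcard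
  obtain ⟨a, ha, b, hb, hab⟩ := Finset.one_lt_card.1 hcard
  obtain ⟨ha, hva⟩ := Finset.mem_filter.1 ha
  obtain ⟨hb, hvb⟩ := Finset.mem_filter.1 hb
  obtain ⟨k, hk, hvk, hak, hbk⟩ := exists_common_not_adj h m hv ha hb hva hvb
  obtain ⟨k', hk', hkk', hvk'⟩ : ∃ k' ∉ L, k ≠ k' ∧ ¬ G.Adj v k' := by
    by_contra! H
    exact hab (eq_of_adj_of_almost_complete h m hv ha hb hva hvb hk hvk
      fun j hj hjk => H j hj hjk.symm)
  have hak' := not_adj_of_common_not_adj h m hv ha hva hvb hab hk hvk hak hbk hk' hkk' hvk'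
  have hbk' := not_adj_of_common_not_adj h m hv hb hvb hva hab.symm hk hvk hbk hak hk' hkk'
    hvk'
  have hadj := m.adj k hk k' hk' hkk'
  have hpriv : ∀ x, G.Adj k x → ¬ G.Adj v x → x = k' := fun x hkx hvx =>
    h.eq_of_private_neighbors hvk hab hva hvb (fun e => hak e.symm) (fun e => hbk e.symm)
      hkx hadj hvx hvk'
  have hpriv' : ∀ x, G.Adj k' x → ¬ G.Adj v x → x = k := fun x hkx hvx =>
    h.eq_of_private_neighbors hvk' hab hva hvb (fun e => hak' e.symm) (fun e => hbk' e.symm)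
      hkx hadj.symm hvx hvk
  have hmiss : ∀ c ∈ L, G.Adj v c → ¬ G.Adj c k ∧ ¬ G.Adj c k' := by
    intro c hc hvc
    by_cases hca : c = a
    · subst hca
      exact ⟨hak, hak'⟩
    obtain ⟨j, hj, hvj, hcj, haj⟩ := exists_common_not_adj h m hv hc ha hvc hva
    have := fun i (hi : i ∉ L) (hji : j ≠ i) (hvi : ¬ G.Adj v i) =>
      not_adj_of_common_not_adj h m hv hc hvc hva hca hj hvj hcj haj hi hji hvi
    constructor
    · by_cases hjk : j = k
      · exact hjk ▸ hcj
      · exact this k hk hjk hvk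
    · by_cases hjk : j = k'
      · exact hjk ▸ hcj
      · exact this k' hk' hjk hvk'
  have hkL : ∀ c ∈ L, ¬ G.Adj k c := by
    intro c hc hkc
    by_cases hvc : G.Adj v c
    · exact (hmiss c hc hvc).1 hkc.symm
    · exact hk' (hpriv c hkc hvc ▸ hc)
  have hkL' : ∀ c ∈ L, ¬ G.Adj k' c := by
    intro c hc hkc
    by_cases hvc : G.Adj v c
    · exact (hmiss c hc hvc).2 hkc.symm
    · exact hk (hpriv' c hkc hvc ▸ hc)
  have hvN : ∀ j ∉ L, j ≠ k → j ≠ k' → G.Adj v j := by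
    intro j hj hjk hjk'
    by_contra hvj
    exact hjk' (hpriv j (m.adj k hk j hj hjk.symm) hvj)
  have h₁ := m.min (insert k' (insert k (L.erase v))) (by
    have := m.adj
    have := G.adj_comm
    simp only [Finset.mem_insert, Finset.mem_erase]
    grind)
  have h₂ := G.dartsWithin_insert_erase_add hv hk
  have h₃ : (L.filter (fun u => G.Adj k u)).card = 0 := by
    simpa [Finset.filter_eq_empty_iff] using hkL
  have h₄ := G.dartsWithin_insert (L := insert k (L.erase v)) (x := k')
    (by simp [hkk'.symm, hk'])
  have h₅ : ((insert k (L.erase v)).filter (fun u => G.Adj k' u)).card ≤ 1 := by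
    refine Finset.card_le_card (t := {k}) ?_
    intro x hx
    simp only [Finset.mem_filter, Finset.mem_insert, Finset.mem_erase] at hx
    have := hkL' x
    simp only [Finset.mem_singleton]
    tauto
  omega

end IsMinCocliqueSide

/-- Every hereditary total domishold graph is a `(1,2)`-polar chordal graph: its vertex set
splits into a clique `K` and a set `L` inducing a subgraph of maximum degree at most `1`,
and it has no induced cycle of length at least `4`. -/
theorem stmt_18 {V : Type*} [Fintype V] [DecidableEq V] (G : SimpleGraph V)
    [DecidableRel G.Adj] (h : HereditaryTD G) :
    (∃ K L : Finset V, K ∪ L = Finset.univ ∧ Disjoint K L ∧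
      (∀ u ∈ K, ∀ v ∈ K, u ≠ v → G.Adj u v) ∧
      (∀ v ∈ L, (L.filter (fun u => G.Adj v u)).card ≤ 1)) ∧
    (∀ n : ℕ, 4 ≤ n → IsEmpty (SimpleGraph.cycleGraph n ↪g G)) := by
  refine ⟨?_, fun n hn => h.isEmpty_cycleGraph_embedding hn⟩
  obtain ⟨L, hL, hmin⟩ := Finset.exists_min_image
    (Finset.univ.filter fun L : Finset V => ∀ u ∉ L, ∀ v ∉ L, u ≠ v → G.Adj u v)
    G.dartsWithin ⟨Finset.univ, by simp⟩
  simp only [Finset.mem_filter, Finset.mem_univ, true_and] at hL hmin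
  have m : IsMinCocliqueSide G L := ⟨hL, hmin⟩
  refine ⟨Lᶜ, L, compl_sup_eq_top, disjoint_compl_left, ?_, fun v hv => m.card_filter_adj_le_one h hv⟩
  exact fun u hu v hv => hL u (Finset.mem_compl.1 hu) v (Finset.mem_compl.1 hv)
end
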